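/- Let G be a finite group and S = (S_1, …, S_k) a fully refined internal direct product decomposition of G. Then S is the unique fully refined internal direct product decomposition of G (i.e., every fully refined internal direct product decomposition of G consists, up to reordering, of the same subgroups S_1, …, S_k) if and only if for all distinct i, j ∈ {1,…,k}, the orders |S_i/[S_i,S_i]| and |Z(S_j)| are coprime. -/

import Mathlib

/-- An internal direct product decomposition of a group `G`: a finite family of normal
subgroups such that the multiplication map from the external direct product to `G` is a
group isomorphism. -/
def IsDirectProductDecomp {G : Type*} [Group G] {k : ℕ} (S : Fin k → Subgroup G) : Prop :=
  (∀ i, (S i).Normal) ∧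
    ∃ e : ((i : Fin k) → (S i)) ≃* G, ∀ f, e f = (List.ofFn fun i => ((f i : G))).prod

/-- A group is directly indecomposable if it is nontrivial and in every internal direct
product decomposition into two subgroups, one of the two subgroups is trivial. -/
def DirectlyIndecomposable (H : Type*) [Group H] : Prop :=
  Nontrivial H ∧ ∀ A B : Subgroup H, IsDirectProductDecomp ![A, B] → A = ⊥ ∨ B = ⊥

/-- A decomposition is fully refined if each factor is directly indecomposable. -/
def FullyRefined {G : Type*} [Group G] {k : ℕ} (S : Fin k → Subgroup G) : Prop :=
  IsDirectProductDecomp S ∧ ∀ i, DirectlyIndecomposable (S i)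

/-- Projections attached to a decomposition. -/
lemma exists_projections {G : Type*} [Group G] {k : ℕ} {S : Fin k → Subgroup G}
    (h : IsDirectProductDecomp S) :
    ∃ π : Fin k → G →* G, (∀ i g, π i g ∈ S i) ∧ (∀ i, ∀ s ∈ S i, π i s = s) ∧
      (∀ i j, i ≠ j → ∀ s ∈ S j, π i s = 1) ∧ (∀ g, (∀ i, π i g = 1) → g = 1) ∧
      (∀ φ : G →* G, (∀ i, ∀ s ∈ S i, φ s = 1) → ∀ g, φ g = 1) ∧
      (∀ i x g, x * π i g * x⁻¹ = π i (x * g * x⁻¹)) := by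
  classical
  obtain ⟨hn, e, he⟩ := h
  have hsingle : ∀ i (s : S i), e (Pi.mulSingle i s) = s := by
    intro i s
    rw [he]
    have : (fun l => ((Pi.mulSingle i s : (l : Fin k) → S l) l : G))
        = Pi.mulSingle i (s : G) := by
      funext l
      by_cases hl : l = i
      · subst hl; simp
      · simp [Pi.mulSingle_eq_of_ne hl]
    rw [this]
    have key : ∀ (n : ℕ) (i : Fin n) (s : G),
        (List.ofFn (Pi.mulSingle i s : Fin n → G)).prod = s := by
      intro n
      induction n with
      | zero => intro i; exact i.elim0
      | succ n ih =>
        intro i s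
        rw [List.ofFn_succ, List.prod_cons]
        refine Fin.cases ?_ (fun i => ?_) i
        · have : (fun l : Fin n => (Pi.mulSingle (0 : Fin (n+1)) s : Fin (n+1) → G) l.succ)
              = fun _ => 1 := by
            funext l; simp [Pi.mulSingle_apply]
          rw [this]; simp
        · have : (fun l : Fin n => (Pi.mulSingle i.succ s : Fin (n+1) → G) l.succ)
              = Pi.mulSingle i s := by
            funext l; simp [Pi.mulSingle_apply]
          rw [this, ih]; simp [Pi.mulSingle_apply]
    exact key k i s
  let π : Fin k → G →* G := fun i =>
    ((S i).subtype.comp (Pi.evalMonoidHom (fun l => S l) i)).comp e.symm.toMonoidHom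
  have hπ : ∀ i g, π i g = ((e.symm g) i : G) := fun i g => rfl
  have hs : ∀ i (s : G) (hs : s ∈ S i), e.symm s = Pi.mulSingle i ⟨s, hs⟩ := by
    intro i s hs
    rw [MulEquiv.symm_apply_eq, hsingle]
  have hmem : ∀ i g, π i g ∈ S i := fun i g => by rw [hπ]; exact Subtype.property _
  have hid : ∀ i, ∀ s ∈ S i, π i s = s := fun i s h => by rw [hπ, hs i s h]; simp
  refine ⟨π, hmem, hid, ?_, ?_, ?_, ?_⟩
  · intro i j hij s h
    rw [hπ, hs j s h, Pi.mulSingle_eq_of_ne hij]; rfl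
  · intro g hg
    apply e.symm.injective
    rw [map_one]
    funext i
    exact Subtype.ext (hg i)
  · intro φ hφ g
    obtain ⟨f, rfl⟩ := e.surjective g
    rw [he, map_list_prod]
    apply List.prod_eq_one
    intro x hx
    simp only [List.mem_map, List.mem_ofFn] at hx
    obtain ⟨_, ⟨i, rfl⟩, rfl⟩ := hx
    exact hφ i _ (f i).2
  · intro i x g
    have h1 : x * π i g * x⁻¹ ∈ S i := (hn i).conj_mem _ (hmem i g) x
    rw [← hid i _ h1]
    simp only [map_mul, hid i _ (hmem i g)]

lemma decomp_pair {H : Type*} [Group H] (A B : Subgroup H) (hA : A.Normal) (hB : B.Normal)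
    (hd : Disjoint A B) (hs : ∀ h : H, ∃ a ∈ A, ∃ b ∈ B, a * b = h) :
    IsDirectProductDecomp ![A, B] := by
  have hc : ∀ a ∈ A, ∀ b ∈ B, Commute a b := fun a ha b hb =>
    Subgroup.commute_of_normal_of_disjoint A B hA hB hd a b ha hb
  refine ⟨fun i => by fin_cases i <;> assumption, ?_⟩
  let F : ((i : Fin 2) → (![A, B] i : Subgroup H)) →* H :=
    { toFun := fun f => (f 0 : H) * (f 1 : H)
      map_one' := by simp
      map_mul' := by
        intro f g
        have := hc (g 0 : H) (g 0).2 (f 1 : H) (f 1).2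
        simp only [Pi.mul_apply, Subgroup.coe_mul]
        have h2 := this.eq
        calc (f 0 : H) * g 0 * (f 1 * g 1) = f 0 * (g 0 * f 1) * g 1 := by group
          _ = f 0 * (f 1 * g 0) * g 1 := by rw [h2]
          _ = _ := by group }
  have hF : ∀ f, F f = (f 0 : H) * (f 1 : H) := fun _ => rfl
  refine ⟨MulEquiv.ofBijective F ⟨?_, ?_⟩, ?_⟩
  · rw [injective_iff_map_eq_one]
    intro f hf
    rw [hF] at hf
    have h0A : (f 0 : H) ∈ A := (f 0).2
    have h1B : (f 1 : H) ∈ B := (f 1).2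
    have h0 : (f 0 : H) = 1 := by
      apply Subgroup.disjoint_def.1 hd h0A
      rw [eq_inv_of_mul_eq_one_left hf]
      exact B.inv_mem h1B
    have h1 : (f 1 : H) = 1 := by rwa [h0, one_mul] at hf
    funext i
    fin_cases i
    · exact Subtype.ext h0
    · exact Subtype.ext h1
  · intro h
    obtain ⟨a, ha, b, hb, rfl⟩ := hs h
    refine ⟨Fin.cons (⟨a, ha⟩ : A) (Fin.cons (⟨b, hb⟩ : B) finZeroElim), ?_⟩
    rfl
  · intro f
    rw [show (List.ofFn fun i => ((f i : H))).prod = (f 0 : H) * (f 1 : H) by simp [List.ofFn_succ]]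
    exact hF f

lemma fitting_dichotomy {G : Type*} [Group G] (U : Subgroup G) (hU : DirectlyIndecomposable U)
    (p : G →* G) (hp : ∀ u ∈ U, p u ∈ U) (hi : ∀ u ∈ U, p (p u) = p u)
    (hn : ∀ x g, x * p g * x⁻¹ = p (x * g * x⁻¹)) :
    (∀ u ∈ U, p u = u) ∨ (∀ u ∈ U, p u = 1) := by
  let A : Subgroup U := (p.eqLocus (MonoidHom.id G)).subgroupOf U
  let B : Subgroup U := p.ker.subgroupOf U
  have memA : ∀ u : U, u ∈ A ↔ p u = u := fun u => Iff.rfl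
  have memB : ∀ u : U, u ∈ B ↔ p u = 1 := fun u => Iff.rfl
  have hd : IsDirectProductDecomp ![A, B] := by
    apply decomp_pair
    · refine ⟨fun n hh g => ?_⟩
      rw [memA] at hh ⊢
      push_cast
      rw [← hn, hh]
    · infer_instance
    · rw [Subgroup.disjoint_def]
      intro x hx hx'
      rw [memA] at hx
      rw [memB] at hx'
      exact Subtype.ext (hx.symm.trans hx')
    · intro h
      refine ⟨⟨p h, hp h h.2⟩, (memA _).2 (hi h h.2), ⟨p h, hp h h.2⟩⁻¹ * h, (memB _).2 ?_, by simp⟩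
      simp [hi h h.2]
  rcases hU.2 A B hd with h | h
  · right
    intro u hu
    have : (⟨p u, hp u hu⟩ : U) ∈ A := (memA _).2 (hi u hu)
    rw [h, Subgroup.mem_bot] at this
    exact congrArg Subtype.val this
  · left
    intro u hu
    have : (⟨p u, hp u hu⟩ : U)⁻¹ * ⟨u, hu⟩ ∈ B := (memB _).2 (by simp [hi u hu])
    rw [h, Subgroup.mem_bot] at this
    exact congrArg Subtype.val (inv_mul_eq_one.1 this)

lemma decomp_map {G H : Type*} [Group G] [Group H] {k : ℕ} {S : Fin k → Subgroup G}
    (h : IsDirectProductDecomp S) (α : G ≃* H) :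
    IsDirectProductDecomp (fun i => (S i).map (α : G →* H)) := by
  obtain ⟨hn, e, he⟩ := h
  refine ⟨fun i => (hn i).map _ α.surjective, ?_⟩
  refine ⟨((MulEquiv.piCongrRight fun i => α.subgroupMap (S i)).symm.trans e).trans α, ?_⟩
  intro f
  obtain ⟨f, rfl⟩ := (MulEquiv.piCongrRight fun i => α.subgroupMap (S i)).surjective f
  simp only [MulEquiv.trans_apply, MulEquiv.symm_apply_apply, he]
  rw [map_list_prod, List.map_ofFn]
  rfl

lemma indec_equiv {G H : Type*} [Group G] [Group H] (h : DirectlyIndecomposable G)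
    (α : G ≃* H) : DirectlyIndecomposable H := by
  refine ⟨?_, ?_⟩
  · have := h.1
    exact α.symm.toEquiv.nontrivial
  · intro A B hAB
    have h2 := decomp_map hAB α.symm
    have : (fun i => (![A, B] i).map (α.symm : H →* G))
        = ![A.map (α.symm : H →* G), B.map (α.symm : H →* G)] := by
      funext i; fin_cases i <;> rfl
    rw [this] at h2
    rcases h.2 _ _ h2 with h | h
    · left; exact (Subgroup.map_eq_bot_iff_of_injective A α.symm.injective).1 h
    · right; exact (Subgroup.map_eq_bot_iff_of_injective B α.symm.injective).1 h

lemma exists_hom_ne_one {A Z : Type*} [CommGroup A] [Finite A] [Group Z] [Finite Z]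
    (h : ¬ Nat.Coprime (Nat.card A) (Nat.card Z)) : ∃ φ : A →* Z, ∃ a, φ a ≠ 1 := by
  obtain ⟨p, hp, hpA, hpZ⟩ := Nat.Prime.not_coprime_iff_dvd.1 h
  have : Fact p.Prime := ⟨hp⟩
  obtain ⟨z, hz⟩ := exists_prime_orderOf_dvd_card' p hpZ
  obtain ⟨ι, _, n, hn, ⟨E⟩⟩ := CommGroup.equiv_prod_multiplicative_zmod_of_finite A
  have hcard : Nat.card A = ∏ i, n i := by
    rw [Nat.card_congr E.toEquiv, Nat.card_pi]
    exact Finset.prod_congr rfl fun i _ => by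
      rw [Nat.card_congr Multiplicative.toAdd, Nat.card_zmod]
  rw [hcard] at hpA
  obtain ⟨i, -, hi⟩ := (Prime.dvd_finsetProd_iff hp.prime _).1 hpA
  -- the hom ZMod p → Z
  let ψ : Multiplicative (ZMod p) →* Z :=
    AddMonoidHom.toMultiplicativeLeft (ZMod.lift p ⟨(zmultiplesHom (Additive Z)) (Additive.ofMul z), by
      have : z ^ p = 1 := by rw [← hz]; exact pow_orderOf_eq_one z
      simpa [← ofMul_pow] using this⟩)
  have hψ : ψ (Multiplicative.ofAdd 1) = z := by
    have := ZMod.lift_coe p (⟨(zmultiplesHom (Additive Z)) (Additive.ofMul z), by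
      have : z ^ p = 1 := by rw [← hz]; exact pow_orderOf_eq_one z
      simpa [← ofMul_pow] using this⟩ : {f : ℤ →+ Additive Z // f p = 0}) 1
    simp only [Int.cast_one] at this
    change Additive.toMul (ZMod.lift p _ 1) = z
    rw [this]; simp
  let c : Multiplicative (ZMod (n i)) →* Multiplicative (ZMod p) :=
    AddMonoidHom.toMultiplicative (ZMod.castHom hi (ZMod p)).toAddMonoidHom
  have hc : c (Multiplicative.ofAdd 1) = Multiplicative.ofAdd 1 := by
    change Multiplicative.ofAdd (ZMod.castHom hi (ZMod p) 1) = _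
    rw [map_one]
  classical
  refine ⟨((ψ.comp c).comp (Pi.evalMonoidHom _ i)).comp E.toMonoidHom,
    E.symm (Pi.mulSingle i (Multiplicative.ofAdd 1)), ?_⟩
  simp only [MonoidHom.comp_apply, MulEquiv.coe_toMonoidHom, MulEquiv.apply_symm_apply,
    Pi.evalMonoidHom_apply, Pi.mulSingle_eq_same, hc, hψ]
  rintro rfl
  rw [orderOf_one] at hz
  exact hp.one_lt.ne hz

lemma hom_trivial_of_coprime {A Z : Type*} [Group A] [Finite A] [Group Z] [IsMulCommutative Z] [Finite Z]
    (h : Nat.Coprime (Nat.card (Abelianization A)) (Nat.card Z)) (φ : A →* Z) (a : A) :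
    φ a = 1 := by
  let _ : CommGroup Z := { mul_comm := mul_comm' }
  have h0 : φ a = Abelianization.lift φ (Abelianization.of a) := by simp
  rw [h0]
  set ψ := Abelianization.lift φ
  set b := Abelianization.of a
  rw [← orderOf_eq_one_iff]
  apply Nat.eq_one_of_dvd_coprimes h
  · exact (orderOf_map_dvd ψ b).trans (orderOf_dvd_natCard b)
  · exact orderOf_dvd_natCard _

theorem stmt1 {G : Type*} [Group G] [Fintype G] {k : ℕ} (S : Fin k → Subgroup G)
    (hS : FullyRefined S) :
    (∀ (m : ℕ) (T : Fin m → Subgroup G), FullyRefined T → Set.range T = Set.range S) ↔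
      (∀ i j, i ≠ j →
        Nat.Coprime (Nat.card (Abelianization (S i))) (Nat.card (Subgroup.center (S j)))) := by
  obtain ⟨π, hmem, hid, hne, hsep, hgen, hnorm⟩ := exists_projections hS.1
  constructor
  · intro huniq i j hij
    by_contra hcop
    obtain ⟨φ, a, ha⟩ := exists_hom_ne_one hcop
    let z : G →* G := (((S j).subtype.comp (Subgroup.center (S j)).subtype).comp φ).comp
      (Abelianization.of.comp ((π i).codRestrict (S i) (hmem i)))
    have hz : ∀ g, z g = ((φ (Abelianization.of ⟨π i g, hmem i g⟩) : S j) : G) := fun _ => rfl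
    have hzj : ∀ g, z g ∈ S j := fun g => by rw [hz]; exact Subtype.property _
    have hzc : ∀ g x, x * z g = z g * x := by
      intro g x
      have h1 : x * z g * x⁻¹ = z g := by
        have h2 := hnorm j x (z g)
        rw [hid j _ (hzj g)] at h2
        rw [h2]
        simp only [map_mul, map_inv, hid j _ (hzj g)]
        have h3 := Subgroup.mem_center_iff.1
          (φ (Abelianization.of ⟨π i g, hmem i g⟩)).2 ⟨π j x, hmem j x⟩
        have h4 := congrArg Subtype.val h3
        simp only [Subgroup.coe_mul, ← hz] at h4
        rw [h4]; group
      exact mul_inv_eq_iff_eq_mul.1 h1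
    have hzz : ∀ g, π i (z g) = 1 := fun g => hne i j hij _ (hzj g)
    have hz1 : ∀ g, π i g = 1 → z g = 1 := by
      intro g hg
      have : (⟨π i g, hmem i g⟩ : S i) = 1 := Subtype.ext hg
      rw [hz, this]; simp
    let α₀ : G →* G :=
      { toFun := fun g => g * z g
        map_one' := by simp
        map_mul' := by
          intro x y
          rw [map_mul]
          calc x * y * (z x * z y) = x * (y * z x) * z y := by group
            _ = x * (z x * y) * z y := by rw [hzc x y]
            _ = _ := by group }
    have hα₀ : ∀ g, α₀ g = g * z g := fun _ => rfl
    have hinj : Function.Injective α₀ := by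
      rw [injective_iff_map_eq_one]
      intro g hg
      rw [hα₀] at hg
      have h1 : π i g = 1 := by
        have := congrArg (π i) hg
        simpa [hzz] using this
      rwa [hz1 g h1, mul_one] at hg
    let α : G ≃* G := MulEquiv.ofBijective α₀ (Finite.injective_iff_bijective.1 hinj)
    have hα : ∀ g, α g = g * z g := fun _ => rfl
    have hT : FullyRefined (fun i => (S i).map (α : G →* G)) :=
      ⟨decomp_map hS.1 α, fun l => indec_equiv (hS.2 l) (α.subgroupMap (S l))⟩
    have hr := huniq k _ hT
    have hmemr : (S i).map (α : G →* G) ∈ Set.range S := hr ▸ ⟨i, rfl⟩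
    obtain ⟨l, hl⟩ := hmemr
    obtain ⟨s, rfl⟩ := QuotientGroup.mk_surjective a
    have hzs : z s ≠ 1 := by
      intro h
      apply ha
      rw [hz] at h
      have h5 : (⟨π i s, hmem i s⟩ : S i) = s := Subtype.ext (hid i s s.2)
      rw [h5] at h
      exact Subtype.ext (Subtype.ext h)
    have hsl : (s : G) * z s ∈ S l := by
      rw [hl]
      exact ⟨s, s.2, rfl⟩
    by_cases hli : l = i
    · subst hli
      have h6 := hne j l hij.symm _ hsl
      rw [map_mul, hne j l hij.symm _ s.2, one_mul, hid j _ (hzj _)] at h6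
      exact hzs h6
    · have h6 := hne i l (Ne.symm hli) _ hsl
      rw [map_mul, hzz, mul_one] at h6
      exact hzs (hz1 _ h6)
  · intro hcop m T hT
    obtain ⟨τ, tmem, tid, tne, tsep, tgen, tnorm⟩ := exists_projections hT.1
    have hstab : ∀ i j, ∀ s ∈ S i, τ j s ∈ S i := by
      intro i j s hs
      have h1 : ∀ l, l ≠ i → ∀ s ∈ S i, π l (τ j s) = 1 := by
        intro l hl s hs
        let f : S i →* S l := ((π l).codRestrict (S l) (hmem l)).comp ((τ j).comp (S i).subtype)
        have hf : ∀ s, (f s : G) = π l (τ j s) := fun _ => rfl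
        have hfc : ∀ s, f s ∈ Subgroup.center (S l) := by
          intro s
          rw [Subgroup.mem_center_iff]
          intro x
          apply Subtype.ext
          simp only [Subgroup.coe_mul, hf]
          rw [← mul_inv_eq_iff_eq_mul, hnorm, tnorm]
          congr 2
          -- x and s commute
          have hx : ∀ r, π r ((x : G) * s * (x : G)⁻¹ * (s : G)⁻¹) = 1 := by
            intro r
            by_cases hr : r = i
            · subst hr
              simp [hne r l (Ne.symm hl) _ x.2]
            · simp [hne r i hr _ s.2]
          exact mul_inv_eq_one.1 (hsep _ hx)
        let f' : S i →* Subgroup.center (S l) := f.codRestrict _ hfc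
        have h2 := hom_trivial_of_coprime (hcop i l (Ne.symm hl)) f' ⟨s, hs⟩
        exact congrArg (fun y : Subgroup.center (S l) => ((y : S l) : G)) h2
      have h3 : (π i (τ j s))⁻¹ * τ j s = 1 := by
        apply hsep
        intro l
        by_cases hl : l = i
        · subst hl
          simp [hid l _ (hmem l _)]
        · simp [h1 l hl s hs, hne l i hl _ (hmem i _)]
      rw [← inv_mul_eq_one.1 h3]
      exact hmem i _
    have hdich : ∀ i j, (∀ u ∈ S i, τ j u = u) ∨ (∀ u ∈ S i, τ j u = 1) := fun i j =>
      fitting_dichotomy (S i) (hS.2 i) (τ j) (hstab i j) (fun u _ => tid j _ (tmem j u)) (tnorm j)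
    have hkey : ∀ i j, (∃ u ∈ S i, τ j u ≠ 1) → T j = S i := by
      rintro i j ⟨u, hu, hu1⟩
      have h1 : ∀ u ∈ S i, τ j u = u := by
        rcases hdich i j with h | h
        · exact h
        · exact absurd (h u hu) hu1
      have hle : S i ≤ T j := fun v hv => by rw [← h1 v hv]; exact tmem j v
      apply le_antisymm _ hle
      rcases fitting_dichotomy (T j) (hT.2 j) (π i) (fun v _ => hle (hmem i v))
        (fun v _ => hid i _ (hmem i v)) (hnorm i) with h | h
      · intro v hv
        rw [← h v hv]; exact hmem i v
      · exfalso
        apply hu1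
        have := h u (hle hu)
        rw [hid i u hu] at this
        rw [this, map_one]
    ext U
    constructor
    · rintro ⟨j, rfl⟩
      by_contra hcon
      have h1 : ∀ i, ∀ s ∈ S i, τ j s = 1 := by
        intro i s hs
        by_contra h
        exact hcon ⟨i, (hkey i j ⟨s, hs, h⟩).symm⟩
      have h2 := hgen (τ j) h1
      obtain ⟨t, ht⟩ := @exists_ne _ (hT.2 j).1 (1 : T j)
      apply ht
      apply Subtype.ext
      rw [← tid j t t.2]
      exact h2 _
    · rintro ⟨i, rfl⟩
      by_contra hcon
      obtain ⟨t, ht⟩ := @exists_ne _ (hS.2 i).1 (1 : S i)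
      apply ht
      apply Subtype.ext
      apply tsep
      intro j
      by_contra h
      exact hcon ⟨j, hkey i j ⟨t, t.2, h⟩⟩
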